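/- Fix an integer k ≥ 2, integers ℓ and m with 2 ≤ ℓ ≤ k+1 and 0 ≤ m ≤ ℓ, a constant C₀ > 0, and constants C_F, c₁, c₂ > 0. There exists C > 0, depending only on k, ℓ, m, C₀, C_F, c₁, c₂, with the following property: for every h ∈ (0,1], every map F : ℝ² → ℝ² with polynomial components of total degree ≤ k satisfying the isoparametric bounds of order k (with constants C_F, c₁, c₂ and parameter h), every function û : ℝ² → ℝ² that is smooth on a neighborhood of the closure of T̂, and every continuous function v̂ from the closure of T̂ to ℝ² whose restriction to each closed Clough–Tocher subtriangle K̂ᵢ agrees componentwise with a polynomial of total degree ≤ k, if Σ_{j=0}^{m} Σ_{i=1}^{3} |û − v̂|_{H^j(K̂ᵢ)} ≤ C₀ |û|_{H^ℓ(T̂)}, then the Piola transforms u and v of û and v̂ under F satisfy Σ_{i=1}^{3} |u − v|_{H^m(F(K̂ᵢ))} ≤ C h^{ℓ−m} ‖u‖_{H^ℓ(F(T̂))}. -/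

import Mathlib

open Set MeasureTheory Function

noncomputable section

/-- The open reference triangle with vertices (0,0), (1,0), (0,1). -/
def Tref : Set (ℝ × ℝ) := {x | 0 < x.1 ∧ 0 < x.2 ∧ x.1 + x.2 < 1}

/-- The three vertices of the reference triangle. -/
def vtx : Fin 3 → ℝ × ℝ := ![(0, 0), (1, 0), (0, 1)]

/-- The (open) Clough–Tocher subtriangles, obtained by connecting the barycenter
to the vertices. -/
def ctK (i : Fin 3) : Set (ℝ × ℝ) :=
  interior (convexHull ℝ {vtx i, vtx (i + 1), ((1 : ℝ) / 3, (1 : ℝ) / 3)})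

/-- A map `ℝ² → ℝ²` whose two components are polynomials of total degree ≤ k. -/
def IsPolyMap (k : ℕ) (F : ℝ × ℝ → ℝ × ℝ) : Prop :=
  ∃ P Q : MvPolynomial (Fin 2) ℝ, P.totalDegree ≤ k ∧ Q.totalDegree ≤ k ∧
    ∀ x : ℝ × ℝ,
      F x = (MvPolynomial.eval ![x.1, x.2] P, MvPolynomial.eval ![x.1, x.2] Q)

/-- The Jacobian determinant of `F`. -/
def jacDet (F : ℝ × ℝ → ℝ × ℝ) (x : ℝ × ℝ) : ℝ :=
  LinearMap.det ((fderiv ℝ F x) : (ℝ × ℝ) →ₗ[ℝ] (ℝ × ℝ))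

/-- The Piola matrix `A(x) = DF(x) / det DF(x)`. -/
def Amap (F : ℝ × ℝ → ℝ × ℝ) (x : ℝ × ℝ) : (ℝ × ℝ) →L[ℝ] (ℝ × ℝ) :=
  (jacDet F x)⁻¹ • fderiv ℝ F x

/-- `B(x) = det DF(x) · (DF(x))⁻¹`, the adjugate of `DF`. -/
def Bmap (F : ℝ × ℝ → ℝ × ℝ) (x : ℝ × ℝ) : (ℝ × ℝ) →L[ℝ] (ℝ × ℝ) :=
  jacDet F x • Ring.inverse (fderiv ℝ F x)

/-- `v` is the Piola transform of `v̂` under `F`. -/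
def IsPiola (F vh v : ℝ × ℝ → ℝ × ℝ) : Prop :=
  ∀ x ∈ closure Tref, v (F x) = Amap F x (vh x)

/-- The `W^{m,p}` seminorm over a set `S` (for `p < ∞`). -/
def semiLp {E : Type*} [NormedAddCommGroup E] [NormedSpace ℝ E]
    (m : ℕ) (p : ℝ) (w : ℝ × ℝ → E) (S : Set (ℝ × ℝ)) : ℝ :=
  (∫ x in S, ‖iteratedFDeriv ℝ m w x‖ ^ p) ^ (1 / p)

/-- The `W^{m,p}` norm over a set `S`: the sum of the seminorms up to order `m`. -/
def normWmp {E : Type*} [NormedAddCommGroup E] [NormedSpace ℝ E]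
    (m : ℕ) (p : ℝ) (w : ℝ × ℝ → E) (S : Set (ℝ × ℝ)) : ℝ :=
  ∑ j ∈ Finset.range (m + 1), semiLp j p w S

/-- The isoparametric bounds of order `k` with constants `CF, c₁, c₂` and parameter `h`. -/
def IsoparamBounds (k : ℕ) (CF c₁ c₂ h : ℝ) (F : ℝ × ℝ → ℝ × ℝ) : Prop :=
  InjOn F (closure Tref) ∧
  (∀ m : ℕ, m ≤ k → ∀ x ∈ Tref, ‖iteratedFDeriv ℝ m F x‖ ≤ CF * h ^ m) ∧
  (∀ m : ℕ, m ≤ k + 1 → ∀ y ∈ F '' Tref,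
    ‖iteratedFDeriv ℝ m (invFunOn F (closure Tref)) y‖ ≤ CF * h ^ (-(m : ℤ))) ∧
  (∀ x ∈ closure Tref, c₁ * h ^ 2 ≤ jacDet F x ∧ jacDet F x ≤ c₂ * h ^ 2)


/-- The (planar) divergence of a vector field. -/
def pdiv (w : ℝ × ℝ → ℝ × ℝ) (x : ℝ × ℝ) : ℝ :=
  (fderiv ℝ w x (1, 0)).1 + (fderiv ℝ w x (0, 1)).2

open scoped ContDiff

/-- `f` is smooth and all its derivatives of order `> a` vanish. -/
def VDeg {G : Type*} [NormedAddCommGroup G] [NormedSpace ℝ G] (a : ℕ) (f : ℝ × ℝ → G) : Prop :=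
  ContDiff ℝ ∞ f ∧ ∀ i, a < i → ∀ x, ‖iteratedFDeriv ℝ i f x‖ = 0

lemma VDeg.mono {G : Type*} [NormedAddCommGroup G] [NormedSpace ℝ G] {a b : ℕ}
    {f : ℝ × ℝ → G} (h : VDeg a f) (hab : a ≤ b) : VDeg b f :=
  ⟨h.1, fun i hi x => h.2 i (by omega) x⟩

lemma natCast_le_infty (n : ℕ) : (n : WithTop ℕ∞) ≤ ∞ := by
  exact_mod_cast le_top

lemma VDeg.mul {a b : ℕ} {f g : ℝ × ℝ → ℝ} (hf : VDeg a f) (hg : VDeg b g) :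
    VDeg (a + b) (fun x => f x * g x) := by
  refine ⟨hf.1.mul hg.1, fun i hi x => le_antisymm ?_ (norm_nonneg _)⟩
  refine (norm_iteratedFDeriv_mul_le hf.1 hg.1 x (natCast_le_infty i)).trans ?_
  refine Finset.sum_nonpos fun j hj => ?_
  by_cases hja : a < j
  · rw [hf.2 j hja]; simp
  · rw [hg.2 (i - j) (by omega)]; simp

lemma VDeg.add {a : ℕ} {f g : ℝ × ℝ → ℝ} (hf : VDeg a f) (hg : VDeg a g) :
    VDeg a (fun x => f x + g x) := by
  refine ⟨hf.1.add hg.1, fun i hi x => ?_⟩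
  have : (fun x => f x + g x) = f + g := rfl
  rw [this, iteratedFDeriv_add_apply ((hf.1.of_le (natCast_le_infty i)).contDiffAt)
    ((hg.1.of_le (natCast_le_infty i)).contDiffAt), norm_eq_zero.1 (hf.2 i hi x),
    norm_eq_zero.1 (hg.2 i hi x)]
  simp

lemma VDeg.const (c : ℝ) : VDeg 0 (fun _ : ℝ × ℝ => c) := by
  refine ⟨contDiff_const, fun i hi x => ?_⟩
  rw [iteratedFDeriv_const_of_ne (by omega)]
  simp

lemma VDeg.clm (L : ℝ × ℝ →L[ℝ] ℝ) : VDeg 1 L := by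
  refine ⟨L.contDiff, fun i hi x => ?_⟩
  obtain ⟨j, rfl⟩ : ∃ j, i = j + 1 := ⟨i - 1, by omega⟩
  rw [← norm_iteratedFDeriv_fderiv]
  have : fderiv ℝ L = fun _ => L := by ext1 x; exact L.fderiv
  rw [this, iteratedFDeriv_const_of_ne (by omega)]
  simp

lemma VDeg.pow {a : ℕ} {f : ℝ × ℝ → ℝ} (hf : VDeg a f) (n : ℕ) :
    VDeg (n * a) (fun x => f x ^ n) := by
  induction n with
  | zero => simpa using VDeg.const 1
  | succ n ih =>
    have := ih.mul hf
    simp only [pow_succ]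
    exact this.mono (by rw [Nat.succ_mul])

lemma VDeg.sum {ι : Type*} {a : ℕ} (s : Finset ι) (f : ι → ℝ × ℝ → ℝ)
    (hf : ∀ i ∈ s, VDeg a (f i)) : VDeg a (fun x => ∑ i ∈ s, f i x) := by
  classical
  induction s using Finset.induction_on with
  | empty => simpa using (VDeg.const 0).mono (Nat.zero_le a)
  | insert i s hi ih =>
    simp only [Finset.sum_insert hi]
    exact (hf i (by simp)).add (ih fun j hj => hf j (by simp [hj]))

lemma VDeg.poly (P : MvPolynomial (Fin 2) ℝ) {k : ℕ} (hP : P.totalDegree ≤ k) :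
    VDeg k (fun x : ℝ × ℝ => MvPolynomial.eval ![x.1, x.2] P) := by
  simp only [MvPolynomial.eval_eq', Fin.prod_univ_two]
  refine VDeg.sum _ _ fun d hd => ?_
  have h1 : VDeg (0 + (d 0 * 1 + d 1 * 1)) (fun x : ℝ × ℝ => P.coeff d * (x.1 ^ d 0 * x.2 ^ d 1)) :=
    (VDeg.const _).mul (((VDeg.clm (ContinuousLinearMap.fst ℝ ℝ ℝ)).pow (d 0)).mul
      ((VDeg.clm (ContinuousLinearMap.snd ℝ ℝ ℝ)).pow (d 1)))
  have h2 := MvPolynomial.le_totalDegree hd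
  rw [Finsupp.sum_fintype _ _ (by simp)] at h2
  simp only [Fin.sum_univ_two] at h2
  exact h1.mono (by omega)

lemma VDeg.prodMk {a : ℕ} {f g : ℝ × ℝ → ℝ} (hf : VDeg a f) (hg : VDeg a g) :
    VDeg a (fun x => (f x, g x)) := by
  refine ⟨hf.1.prodMk hg.1, fun i hi x => ?_⟩
  have e : (fun x => (f x, g x)) = (ContinuousLinearMap.inl ℝ ℝ ℝ ∘ f)
      + (ContinuousLinearMap.inr ℝ ℝ ℝ ∘ g) := by
    ext x <;> simp
  have hf1 := (hf.1.of_le (natCast_le_infty i)).contDiffAt (x := x)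
  have hg1 := (hg.1.of_le (natCast_le_infty i)).contDiffAt (x := x)
  rw [e, iteratedFDeriv_add_apply ((ContinuousLinearMap.inl ℝ ℝ ℝ).contDiff.contDiffAt.comp x hf1)
    ((ContinuousLinearMap.inr ℝ ℝ ℝ).contDiff.contDiffAt.comp x hg1),
    ContinuousLinearMap.iteratedFDeriv_comp_left _ hf1 le_rfl,
    ContinuousLinearMap.iteratedFDeriv_comp_left _ hg1 le_rfl,
    norm_eq_zero.1 (hf.2 i hi x), norm_eq_zero.1 (hg.2 i hi x)]
  simp only [norm_eq_zero]
  ext m <;> simp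

lemma IsPolyMap.vdeg {k : ℕ} {F : ℝ × ℝ → ℝ × ℝ} (hF : IsPolyMap k F) : VDeg k F := by
  obtain ⟨P, Q, hP, hQ, h⟩ := hF
  have : F = fun x => (MvPolynomial.eval ![x.1, x.2] P, MvPolynomial.eval ![x.1, x.2] Q) :=
    funext h
  rw [this]
  exact (VDeg.poly P hP).prodMk (VDeg.poly Q hQ)

/-! Geometry of the triangles -/

lemma isOpen_Tref : IsOpen Tref := by
  unfold Tref
  exact (isOpen_lt continuous_const continuous_fst).inter
    ((isOpen_lt continuous_const continuous_snd).inter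
      (isOpen_lt (continuous_fst.add continuous_snd) continuous_const))

lemma isCompact_closure_Tref : IsCompact (closure Tref) := by
  refine (isCompact_Icc (a := ((0, 0) : ℝ × ℝ)) (b := (1, 1))).closure_of_subset ?_
  rintro ⟨x, y⟩ ⟨h1, h2, h3⟩
  simp only at h1 h2 h3
  refine ⟨⟨h1.le, h2.le⟩, ⟨?_, ?_⟩⟩ <;> simp <;> linarith

lemma isOpen_ctK (i : Fin 3) : IsOpen (ctK i) := isOpen_interior

lemma ctK_subset (i : Fin 3) : ctK i ⊆ Tref := by
  have hc : ∀ L : ℝ × ℝ →L[ℝ] ℝ, Surjective L → ∀ c : ℝ,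
      (∀ p ∈ ({vtx i, vtx (i + 1), ((1 : ℝ) / 3, (1 : ℝ) / 3)} : Set (ℝ × ℝ)), c ≤ L p) →
      ∀ x ∈ ctK i, c < L x := by
    intro L hL c hp x hx
    have h1 : convexHull ℝ ({vtx i, vtx (i + 1), ((1 : ℝ) / 3, (1 : ℝ) / 3)} : Set (ℝ × ℝ))
        ⊆ L ⁻¹' Ici c := by
      refine convexHull_min hp ?_
      exact (convex_Ici c).linear_preimage L.toLinearMap
    have h2 := interior_mono h1 hx
    rw [← (L.isOpenMap hL).preimage_interior_eq_interior_preimage L.continuous,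
      interior_Ici] at h2
    exact h2
  intro x hx
  refine ⟨?_, ?_, ?_⟩
  · refine hc (ContinuousLinearMap.fst ℝ ℝ ℝ) Prod.fst_surjective 0 ?_ x hx
    intro p hp
    fin_cases i <;> simp [vtx] at hp <;> rcases hp with rfl | rfl | rfl <;> norm_num
  · refine hc (ContinuousLinearMap.snd ℝ ℝ ℝ) Prod.snd_surjective 0 ?_ x hx
    intro p hp
    fin_cases i <;> simp [vtx] at hp <;> rcases hp with rfl | rfl | rfl <;> norm_num
  · have := hc (-(ContinuousLinearMap.fst ℝ ℝ ℝ + ContinuousLinearMap.snd ℝ ℝ ℝ))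
      (fun t => ⟨(-t, 0), by simp⟩) (-1) ?_ x hx
    · simp at this; linarith
    intro p hp
    fin_cases i <;> simp [vtx] at hp <;> rcases hp with rfl | rfl | rfl <;> norm_num

/-! Calculus on open sets -/

section CalcOpen
variable {X Y Z : Type*} [NormedAddCommGroup X] [NormedSpace ℝ X]
  [NormedAddCommGroup Y] [NormedSpace ℝ Y] [NormedAddCommGroup Z] [NormedSpace ℝ Z]

lemma comp_bound {g : Y → Z} {f : X → Y} {S : Set X} {T : Set Y} (hS : IsOpen S) (hT : IsOpen T)
    (hg : ContDiffOn ℝ ∞ g T) (hf : ContDiffOn ℝ ∞ f S) (hm : MapsTo f S T) {x : X} (hx : x ∈ S)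
    (n : ℕ) {C D : ℝ} (hC : ∀ i ≤ n, ‖iteratedFDeriv ℝ i g (f x)‖ ≤ C)
    (hD : ∀ i : ℕ, 1 ≤ i → i ≤ n → ‖iteratedFDeriv ℝ i f x‖ ≤ D ^ i) :
    ‖iteratedFDeriv ℝ n (fun z => g (f z)) x‖ ≤ n.factorial * C * D ^ n := by
  have := norm_iteratedFDerivWithin_comp_le (n := n) hg hf (natCast_le_infty n) hT.uniqueDiffOn
    hS.uniqueDiffOn hm hx (C := C) (D := D)
    (fun i hi => by rw [iteratedFDerivWithin_of_isOpen i hT (hm hx)]; exact hC i hi)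
    (fun i h1 hi => by rw [iteratedFDerivWithin_of_isOpen i hS hx]; exact hD i h1 hi)
  rw [iteratedFDerivWithin_of_isOpen n hS hx] at this
  exact this

lemma leibniz_arith (n : ℕ) (f g : ℕ → ℝ) (a b h : ℝ) (hh : 0 ≤ h) (ha : 0 ≤ a)
    (hg0 : ∀ i, 0 ≤ g i)
    (hf : ∀ i ≤ n, f i ≤ a * h ^ i) (hg : ∀ i ≤ n, g i ≤ b * h ^ i) :
    ∑ i ∈ Finset.range (n + 1), (n.choose i : ℝ) * f i * g (n - i) ≤ 2 ^ n * (a * b) * h ^ n := by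
  have h2 : ((2 : ℝ) ^ n) = ∑ i ∈ Finset.range (n + 1), (n.choose i : ℝ) := by
    exact_mod_cast (Nat.sum_range_choose n).symm
  rw [h2, Finset.sum_mul, Finset.sum_mul]
  refine Finset.sum_le_sum fun i hi => ?_
  have hi' : i ≤ n := by simpa [Nat.lt_succ_iff] using hi
  have e : h ^ n = h ^ i * h ^ (n - i) := by rw [← pow_add]; congr 1; omega
  rw [e, mul_assoc, mul_assoc]
  refine mul_le_mul_of_nonneg_left ?_ (Nat.cast_nonneg _)
  calc f i * g (n - i) ≤ (a * h ^ i) * (b * h ^ (n - i)) :=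
        mul_le_mul (hf i hi') (hg _ (by omega)) (hg0 _) (by positivity)
    _ = _ := by ring

lemma clm_bound {f : X → Y →L[ℝ] Z} {g : X → Y} {S : Set X} (hS : IsOpen S)
    (hf : ContDiffOn ℝ ∞ f S) (hg : ContDiffOn ℝ ∞ g S) {x : X} (hx : x ∈ S) (n : ℕ)
    {a b h : ℝ} (hh : 0 ≤ h) (ha : 0 ≤ a)
    (hfb : ∀ i ≤ n, ‖iteratedFDeriv ℝ i f x‖ ≤ a * h ^ i)
    (hgb : ∀ i ≤ n, ‖iteratedFDeriv ℝ i g x‖ ≤ b * h ^ i) :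
    ‖iteratedFDeriv ℝ n (fun y => f y (g y)) x‖ ≤ 2 ^ n * (a * b) * h ^ n := by
  have := norm_iteratedFDerivWithin_clm_apply hf hg hS.uniqueDiffOn hx (natCast_le_infty n)
  simp only [iteratedFDerivWithin_of_isOpen _ hS hx] at this
  exact this.trans (leibniz_arith n (fun i => ‖iteratedFDeriv ℝ i f x‖)
    (fun i => ‖iteratedFDeriv ℝ i g x‖) a b h hh ha (fun _ => norm_nonneg _) hfb hgb)

lemma smul_bound {f : X → ℝ} {g : X → Y} {S : Set X} (hS : IsOpen S)
    (hf : ContDiffOn ℝ ∞ f S) (hg : ContDiffOn ℝ ∞ g S) {x : X} (hx : x ∈ S) (n : ℕ)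
    {a b h : ℝ} (hh : 0 ≤ h) (ha : 0 ≤ a)
    (hfb : ∀ i ≤ n, ‖iteratedFDeriv ℝ i f x‖ ≤ a * h ^ i)
    (hgb : ∀ i ≤ n, ‖iteratedFDeriv ℝ i g x‖ ≤ b * h ^ i) :
    ‖iteratedFDeriv ℝ n (fun y => f y • g y) x‖ ≤ 2 ^ n * (a * b) * h ^ n := by
  have := norm_iteratedFDerivWithin_smul_le hf hg hS.uniqueDiffOn hx (natCast_le_infty n)
  simp only [iteratedFDerivWithin_of_isOpen _ hS hx] at this
  exact this.trans (leibniz_arith n (fun i => ‖iteratedFDeriv ℝ i f x‖)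
    (fun i => ‖iteratedFDeriv ℝ i g x‖) a b h hh ha (fun _ => norm_nonneg _) hfb hgb)

lemma eqOn_iteratedFDeriv {f g : X → Y} {S : Set X} (hS : IsOpen S) (h : EqOn f g S) (n : ℕ)
    {x : X} (hx : x ∈ S) : iteratedFDeriv ℝ n f x = iteratedFDeriv ℝ n g x :=
  (Filter.EventuallyEq.iteratedFDeriv ℝ
    (Filter.eventuallyEq_of_mem (hS.mem_nhds hx) h) n).self_of_nhds

lemma continuousOn_iteratedFDeriv {f : X → Y} {S : Set X} (hS : IsOpen S)
    (hf : ContDiffOn ℝ ∞ f S) (n : ℕ) : ContinuousOn (iteratedFDeriv ℝ n f) S :=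
  (hf.continuousOn_iteratedFDerivWithin (natCast_le_infty n) hS.uniqueDiffOn).congr
    fun _ hx => (iteratedFDerivWithin_of_isOpen n hS hx).symm

end CalcOpen

/-! Adjugate and determinant -/

/-- Evaluation at the first basis vector. -/
def evL : ((ℝ × ℝ) →L[ℝ] (ℝ × ℝ)) →L[ℝ] (ℝ × ℝ) := ContinuousLinearMap.apply ℝ (ℝ × ℝ) (1, 0)

/-- The trace. -/
def trL : ((ℝ × ℝ) →L[ℝ] (ℝ × ℝ)) →L[ℝ] ℝ :=
  (ContinuousLinearMap.fst ℝ ℝ ℝ).comp (ContinuousLinearMap.apply ℝ (ℝ × ℝ) (1, 0)) +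
  (ContinuousLinearMap.snd ℝ ℝ ℝ).comp (ContinuousLinearMap.apply ℝ (ℝ × ℝ) (0, 1))

/-- The adjugate of a planar linear map, as a continuous linear map. -/
def adjL : ((ℝ × ℝ) →L[ℝ] (ℝ × ℝ)) →L[ℝ] ((ℝ × ℝ) →L[ℝ] (ℝ × ℝ)) :=
  trL.smulRight (ContinuousLinearMap.id ℝ (ℝ × ℝ)) - ContinuousLinearMap.id ℝ _

lemma det_formula (M : (ℝ × ℝ) →L[ℝ] (ℝ × ℝ)) :
    LinearMap.det (M : (ℝ × ℝ) →ₗ[ℝ] (ℝ × ℝ)) =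
      (M (1, 0)).1 * (M (0, 1)).2 - (M (0, 1)).1 * (M (1, 0)).2 := by
  rw [← LinearMap.det_toMatrix (Module.Basis.finTwoProd ℝ), Matrix.det_fin_two]
  simp [LinearMap.toMatrix_apply]

lemma clm_expand (M : (ℝ × ℝ) →L[ℝ] (ℝ × ℝ)) (v : ℝ × ℝ) :
    M v = v.1 • M (1, 0) + v.2 • M (0, 1) := by
  rw [← map_smul, ← map_smul, ← map_add]
  congr 1
  ext <;> simp

lemma adjL_mul (M : (ℝ × ℝ) →L[ℝ] (ℝ × ℝ)) (v : ℝ × ℝ) :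
    adjL M (M v) = LinearMap.det (M : (ℝ × ℝ) →ₗ[ℝ] (ℝ × ℝ)) • v := by
  rw [det_formula]
  have e : adjL M (M v) = ((M (1, 0)).1 + (M (0, 1)).2) • M v - M (M v) := by
    simp [adjL, trL]
  rw [e, clm_expand M (M v), clm_expand M v]
  ext <;> simp <;> ring

lemma jacDet_eq (F : ℝ × ℝ → ℝ × ℝ) (x : ℝ × ℝ) :
    jacDet F x = (adjL (fderiv ℝ F x) (evL (fderiv ℝ F x))).1 := by
  have : evL (fderiv ℝ F x) = fderiv ℝ F x (1, 0) := rfl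
  rw [this, adjL_mul]
  simp [jacDet]

lemma adjL_Amap (F : ℝ × ℝ → ℝ × ℝ) (x v : ℝ × ℝ) (h : jacDet F x ≠ 0) :
    adjL (fderiv ℝ F x) (Amap F x v) = v := by
  unfold Amap
  rw [smul_apply, map_smul, adjL_mul, smul_smul]
  change ((jacDet F x)⁻¹ * jacDet F x) • v = v
  rw [inv_mul_cancel₀ h, one_smul]

/-! Bounds for `F` and its derivatives -/

lemma F_bound {k : ℕ} {CF c₁ c₂ h : ℝ} {F : ℝ × ℝ → ℝ × ℝ} (hCF : 0 < CF) (hh : 0 < h)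
    (hV : VDeg k F) (hB : IsoparamBounds k CF c₁ c₂ h F) (r : ℕ) {x : ℝ × ℝ} (hx : x ∈ Tref) :
    ‖iteratedFDeriv ℝ r F x‖ ≤ CF * h ^ r := by
  by_cases hr : r ≤ k
  · exact hB.2.1 r hr x hx
  · rw [hV.2 r (by omega)]; positivity

lemma contDiff_fderiv' {F : ℝ × ℝ → ℝ × ℝ} (hF : ContDiff ℝ ∞ F) :
    ContDiff ℝ ∞ (fderiv ℝ F) := hF.fderiv_right (by simp)

lemma DF_bound {k : ℕ} {CF c₁ c₂ h : ℝ} {F : ℝ × ℝ → ℝ × ℝ} (hCF : 0 < CF) (hh : 0 < h)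
    (hV : VDeg k F) (hB : IsoparamBounds k CF c₁ c₂ h F) (r : ℕ) {x : ℝ × ℝ} (hx : x ∈ Tref) :
    ‖iteratedFDeriv ℝ r (fderiv ℝ F) x‖ ≤ CF * h * h ^ r := by
  rw [norm_iteratedFDeriv_fderiv]
  refine (F_bound hCF hh hV hB (r + 1) hx).trans_eq (by ring)

lemma LDF_bound {G : Type*} [NormedAddCommGroup G] [NormedSpace ℝ G]
    (L : ((ℝ × ℝ) →L[ℝ] (ℝ × ℝ)) →L[ℝ] G)
    {k : ℕ} {CF c₁ c₂ h : ℝ} {F : ℝ × ℝ → ℝ × ℝ} (hCF : 0 < CF) (hh : 0 < h)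
    (hV : VDeg k F) (hB : IsoparamBounds k CF c₁ c₂ h F) (r : ℕ) {x : ℝ × ℝ} (hx : x ∈ Tref) :
    ‖iteratedFDeriv ℝ r (fun y => L (fderiv ℝ F y)) x‖ ≤ ‖L‖ * CF * h * h ^ r := by
  refine (L.norm_iteratedFDeriv_comp_left (contDiff_fderiv' hV.1).contDiffAt
    (natCast_le_infty r)).trans ?_
  rw [mul_assoc, mul_assoc, ← mul_assoc CF]
  exact mul_le_mul_of_nonneg_left (DF_bound hCF hh hV hB r hx) (norm_nonneg _)

lemma contDiff_jacDet {F : ℝ × ℝ → ℝ × ℝ} (hF : ContDiff ℝ ∞ F) :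
    ContDiff ℝ ∞ (jacDet F) := by
  have : jacDet F = fun x => (adjL (fderiv ℝ F x) (evL (fderiv ℝ F x))).1 :=
    funext (jacDet_eq F)
  rw [this]
  have h := contDiff_fderiv' hF
  exact contDiff_fst.comp ((adjL.contDiff.comp h).clm_apply (evL.contDiff.comp h))

/-- The constant in the bound for the determinant. -/
def kap (CF : ℝ) : ℝ :=
  ‖ContinuousLinearMap.fst ℝ ℝ ℝ‖ * (‖adjL‖ * CF * (‖evL‖ * CF))

lemma det_bound {k : ℕ} {CF c₁ c₂ h : ℝ} {F : ℝ × ℝ → ℝ × ℝ} (hCF : 0 < CF) (hh : 0 < h)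
    (hV : VDeg k F) (hB : IsoparamBounds k CF c₁ c₂ h F) (r : ℕ) {x : ℝ × ℝ} (hx : x ∈ Tref) :
    ‖iteratedFDeriv ℝ r (jacDet F) x‖ ≤ kap CF * h ^ 2 * (2 * h) ^ r := by
  have : jacDet F = ContinuousLinearMap.fst ℝ ℝ ℝ ∘
      fun x => (adjL (fderiv ℝ F x) (evL (fderiv ℝ F x))) := funext (jacDet_eq F)
  have hd := contDiff_fderiv' hV.1
  have h1 : ContDiff ℝ ∞ (fun x => adjL (fderiv ℝ F x)) := adjL.contDiff.comp hd
  have h2 : ContDiff ℝ ∞ (fun x => evL (fderiv ℝ F x)) := evL.contDiff.comp hd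
  rw [this]
  refine ((ContinuousLinearMap.fst ℝ ℝ ℝ).norm_iteratedFDeriv_comp_left
    (h1.clm_apply h2).contDiffAt (natCast_le_infty r)).trans ?_
  have := clm_bound isOpen_Tref h1.contDiffOn h2.contDiffOn hx r hh.le
    (a := ‖adjL‖ * CF * h) (b := ‖evL‖ * CF * h) (by positivity)
    (fun i _ => LDF_bound adjL hCF hh hV hB i hx) (fun i _ => LDF_bound evL hCF hh hV hB i hx)
  refine (mul_le_mul_of_nonneg_left this (norm_nonneg _)).trans_eq ?_
  unfold kap
  rw [mul_pow]
  ring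

lemma inv_bound (c₁ t : ℝ) (hc : 0 < c₁) (ht : c₁ ≤ t) (i : ℕ) :
    ‖iteratedFDeriv ℝ i (Inv.inv : ℝ → ℝ) t‖ ≤ i.factorial * c₁⁻¹ ^ (i + 1) := by
  rw [norm_iteratedFDeriv_eq_norm_iteratedDeriv, iteratedDeriv_eq_iterate, iter_deriv_inv]
  have ht0 : 0 < t := hc.trans_le ht
  have e : t ^ (-1 - (i : ℤ)) = t⁻¹ ^ (i + 1) := by
    rw [inv_pow, ← zpow_natCast, ← zpow_neg]; congr 1; push_cast; ring
  rw [e, norm_mul, norm_mul, norm_pow, norm_neg, norm_one, one_pow, one_mul, Real.norm_natCast,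
    Real.norm_of_nonneg (by positivity)]
  gcongr

lemma Q_bound (n : ℕ) (CF c₁ : ℝ) (hCF : 0 < CF) (hc₁ : 0 < c₁) :
    ∃ K : ℝ, 0 < K ∧ ∀ (k : ℕ) (c₂ h : ℝ) (F : ℝ × ℝ → ℝ × ℝ), 0 < h → h ≤ 1 → VDeg k F →
      IsoparamBounds k CF c₁ c₂ h F → ∀ x ∈ Tref, ∀ i ≤ n,
      ‖iteratedFDeriv ℝ i (fun y => ((h ^ 2)⁻¹ • jacDet F y)⁻¹) x‖ ≤ K := by
  set D : ℝ := (1 + kap CF) * 2 with hD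
  have hk : 0 ≤ kap CF := by unfold kap; positivity
  set Ci : ℕ → ℝ := fun n => ∑ i ∈ Finset.range (n + 1), i.factorial * c₁⁻¹ ^ (i + 1) with hCi
  have hCi0 : ∀ n, 0 ≤ Ci n := fun n => Finset.sum_nonneg fun i _ => by positivity
  have hD0 : 0 ≤ D := by positivity
  refine ⟨1 + ∑ i ∈ Finset.range (n + 1), (i.factorial * Ci i * D ^ i), ?_, ?_⟩
  · have : 0 ≤ ∑ i ∈ Finset.range (n + 1), (i.factorial * Ci i * D ^ i) :=
      Finset.sum_nonneg fun i _ => mul_nonneg (mul_nonneg (by positivity) (hCi0 i)) (by positivity)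
    linarith
  intro k c₂ h F hh hh1 hV hB x hx i hi
  have hd : ContDiff ℝ ∞ (fun y => (h ^ 2)⁻¹ • jacDet F y) :=
    (contDiff_jacDet hV.1).const_smul ((h ^ 2)⁻¹)
  have hlow : ∀ y ∈ Tref, c₁ ≤ (h ^ 2)⁻¹ • jacDet F y := by
    intro y hy
    have := (hB.2.2.2 y (subset_closure hy)).1
    rw [smul_eq_mul, le_inv_mul_iff₀ (by positivity)]
    linarith
  have key : ‖iteratedFDeriv ℝ i (fun y => ((h ^ 2)⁻¹ • jacDet F y)⁻¹) x‖
      ≤ i.factorial * Ci i * D ^ i := by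
    refine comp_bound (g := (Inv.inv : ℝ → ℝ)) (f := fun y => (h ^ 2)⁻¹ • jacDet F y)
      isOpen_Tref (isOpen_Ioi (a := (0 : ℝ))) ?_ hd.contDiffOn
      (fun y hy => hc₁.trans_le (hlow y hy)) hx i ?_ ?_
    · exact (contDiffOn_inv ℝ).mono fun t ht => ne_of_gt ht
    · intro j hj
      refine (inv_bound c₁ _ hc₁ (hlow x hx) j).trans ?_
      exact Finset.single_le_sum (f := fun i : ℕ => (i.factorial : ℝ) * c₁⁻¹ ^ (i + 1))
        (fun i _ => by positivity) (by simp; omega)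
    · intro j hj1 hj
      have e : (fun y => (h ^ 2)⁻¹ • jacDet F y) = (h ^ 2)⁻¹ • jacDet F := rfl
      rw [e, iteratedFDeriv_const_smul_apply
        ((contDiff_jacDet hV.1).of_le (natCast_le_infty j)).contDiffAt, norm_smul,
        Real.norm_of_nonneg (by positivity), inv_mul_le_iff₀ (by positivity)]
      refine (det_bound hCF hh hV hB j hx).trans ?_
      have h1 : kap CF ≤ (1 + kap CF) ^ j :=
        (by linarith : kap CF ≤ 1 + kap CF).trans (le_self_pow₀ (by linarith) (by omega))
      have h2 : (2 * h) ^ j ≤ 2 ^ j := by gcongr; linarith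
      rw [hD, mul_pow (1 + kap CF)]
      calc kap CF * h ^ 2 * (2 * h) ^ j ≤ (1 + kap CF) ^ j * h ^ 2 * 2 ^ j := by gcongr
        _ = _ := by ring
  refine key.trans ?_
  have := Finset.single_le_sum (f := fun i : ℕ => (i.factorial : ℝ) * Ci i * D ^ i)
        (s := Finset.range (n + 1))
        (fun i _ => mul_nonneg (mul_nonneg (by positivity) (hCi0 i)) (by positivity))
        (by simp; omega : i ∈ Finset.range (n + 1))
  linarith

lemma contDiffOn_Amap {k : ℕ} {CF c₁ c₂ h : ℝ} {F : ℝ × ℝ → ℝ × ℝ} (hc₁ : 0 < c₁) (hh : 0 < h)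
    (hV : VDeg k F) (hB : IsoparamBounds k CF c₁ c₂ h F) : ContDiffOn ℝ ∞ (Amap F) Tref := by
  refine ContDiffOn.smul (ContDiffOn.inv (contDiff_jacDet hV.1).contDiffOn ?_)
    (contDiff_fderiv' hV.1).contDiffOn
  intro x hx
  have := (hB.2.2.2 x (subset_closure hx)).1
  have : 0 < c₁ * h ^ 2 := by positivity
  linarith

lemma A_bound (n : ℕ) (CF c₁ : ℝ) (hCF : 0 < CF) (hc₁ : 0 < c₁) :
    ∃ K : ℝ, 0 < K ∧ ∀ (k : ℕ) (c₂ h : ℝ) (F : ℝ × ℝ → ℝ × ℝ), 0 < h → h ≤ 1 → VDeg k F →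
      IsoparamBounds k CF c₁ c₂ h F → ∀ x ∈ Tref, ∀ i ≤ n,
      ‖iteratedFDeriv ℝ i (Amap F) x‖ ≤ K * h⁻¹ := by
  obtain ⟨K, hK, H⟩ := Q_bound n CF c₁ hCF hc₁
  refine ⟨2 ^ n * (K * CF), by positivity, ?_⟩
  intro k c₂ h F hh hh1 hV hB x hx i hi
  have hne : ∀ y ∈ Tref, (h ^ 2)⁻¹ • jacDet F y ≠ 0 := by
    intro y hy
    have := (hB.2.2.2 y (subset_closure hy)).1
    have h3 : 0 < c₁ * h ^ 2 := by positivity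
    have : 0 < jacDet F y := by linarith
    positivity
  have hq : ContDiffOn ℝ ∞ (fun y => ((h ^ 2)⁻¹ • jacDet F y)⁻¹) Tref :=
    ContDiffOn.inv ((contDiff_jacDet hV.1).const_smul ((h ^ 2)⁻¹)).contDiffOn hne
  have hM := (contDiff_fderiv' hV.1).contDiffOn (s := Tref)
  have e : EqOn (Amap F)
      ((h ^ 2)⁻¹ • fun y => ((h ^ 2)⁻¹ • jacDet F y)⁻¹ • fderiv ℝ F y) Tref := by
    intro y hy
    simp only [Amap, Pi.smul_apply, smul_smul, smul_eq_mul, mul_inv, inv_inv]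
    congr 1
    field_simp
  have hqM : ContDiffOn ℝ ∞ (fun y => ((h ^ 2)⁻¹ • jacDet F y)⁻¹ • fderiv ℝ F y) Tref :=
    hq.smul hM
  rw [eqOn_iteratedFDeriv isOpen_Tref e i hx, iteratedFDeriv_const_smul_apply
    ((hqM.contDiffAt (isOpen_Tref.mem_nhds hx)).of_le (natCast_le_infty i)),
    norm_smul, Real.norm_of_nonneg (by positivity)]
  have := smul_bound isOpen_Tref hq hM hx i (a := K) (b := CF * h) (h := 1) zero_le_one hK.le
    (fun j hj => by simpa using H k c₂ h F hh hh1 hV hB x hx j (hj.trans hi))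
    (fun j hj => by
      refine (DF_bound hCF hh hV hB j hx).trans ?_
      have : h ^ j ≤ 1 ^ j := by gcongr
      gcongr)
  calc _ ≤ (h ^ 2)⁻¹ * (2 ^ i * (K * (CF * h)) * 1 ^ i) := by gcongr
    _ ≤ (h ^ 2)⁻¹ * (2 ^ n * (K * (CF * h)) * 1) := by
        gcongr
        · norm_num
        · simp
    _ = _ := by field_simp

/-! The inverse map -/

section InverseMap
variable {k : ℕ} {CF c₁ c₂ h : ℝ} {F : ℝ × ℝ → ℝ × ℝ}

lemma jac_pos (hc₁ : 0 < c₁) (hh : 0 < h) (hB : IsoparamBounds k CF c₁ c₂ h F)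
    {x : ℝ × ℝ} (hx : x ∈ Tref) : 0 < jacDet F x := by
  have := (hB.2.2.2 x (subset_closure hx)).1
  have h3 : 0 < c₁ * h ^ 2 := by positivity
  linarith

lemma exists_equiv (hc₁ : 0 < c₁) (hh : 0 < h) (hV : VDeg k F)
    (hB : IsoparamBounds k CF c₁ c₂ h F) {x : ℝ × ℝ} (hx : x ∈ Tref) :
    ∃ e : (ℝ × ℝ) ≃L[ℝ] (ℝ × ℝ), HasFDerivAt F (e : (ℝ × ℝ) →L[ℝ] (ℝ × ℝ)) x := by
  have hdet : (fderiv ℝ F x).det ≠ 0 := (jac_pos hc₁ hh hB hx).ne'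
  refine ⟨(fderiv ℝ F x).toContinuousLinearEquivOfDetNeZero hdet, ?_⟩
  have : DifferentiableAt ℝ F x := (hV.1.differentiable (by simp)) x
  simpa using this.hasFDerivAt

lemma isOpen_image (hc₁ : 0 < c₁) (hh : 0 < h) (hV : VDeg k F)
    (hB : IsoparamBounds k CF c₁ c₂ h F) {K : Set (ℝ × ℝ)} (hK : IsOpen K) (hKT : K ⊆ Tref) :
    IsOpen (F '' K) := by
  rw [isOpen_iff_mem_nhds]
  rintro _ ⟨x, hx, rfl⟩
  obtain ⟨e, he⟩ := exists_equiv hc₁ hh hV hB (hKT hx)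
  have hs : HasStrictFDerivAt F (e : (ℝ × ℝ) →L[ℝ] (ℝ × ℝ)) x :=
    hV.1.contDiffAt.hasStrictFDerivAt' he (by simp)
  rw [← hs.map_nhds_eq_of_equiv]
  exact Filter.image_mem_map (hK.mem_nhds hx)

lemma G_left (hB : IsoparamBounds k CF c₁ c₂ h F) {x : ℝ × ℝ} (hx : x ∈ Tref) :
    invFunOn F (closure Tref) (F x) = x :=
  hB.1.leftInvOn_invFunOn (subset_closure hx)

lemma contDiffOn_G (hc₁ : 0 < c₁) (hh : 0 < h) (hV : VDeg k F)
    (hB : IsoparamBounds k CF c₁ c₂ h F) :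
    ContDiffOn ℝ ∞ (invFunOn F (closure Tref)) (F '' Tref) := by
  rintro _ ⟨x, hx, rfl⟩
  refine ContDiffAt.contDiffWithinAt ?_
  obtain ⟨e, he⟩ := exists_equiv hc₁ hh hV hB hx
  have hc : ContDiffAt ℝ ∞ F x := hV.1.contDiffAt
  have hs : HasStrictFDerivAt F (e : (ℝ × ℝ) →L[ℝ] (ℝ × ℝ)) x :=
    hc.hasStrictFDerivAt' he (by simp)
  have hL : ContDiffAt ℝ ∞ (hs.localInverse F e x) (F x) := hc.to_localInverse he (by simp)
  refine hL.congr_of_eventuallyEq ?_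
  have h1 := hs.eventually_right_inverse
  have h0 : hs.localInverse F e x (F x) = x := hs.localInverse_apply_image
  have h2 : ∀ᶠ y in nhds (F x), hs.localInverse F e x y ∈ Tref := by
    refine hL.continuousAt.eventually ?_
    rw [h0]
    exact isOpen_Tref.mem_nhds hx
  filter_upwards [h1, h2] with y hy1 hy2
  conv_lhs => rw [← hy1]
  exact G_left hB hy2

lemma G_bound (hCF : 0 < CF) (hh : 0 < h) (hB : IsoparamBounds k CF c₁ c₂ h F) {x : ℝ × ℝ}
    (hx : x ∈ Tref) (i : ℕ) (h1 : 1 ≤ i) (hi : i ≤ k + 1) :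
    ‖iteratedFDeriv ℝ i (invFunOn F (closure Tref)) (F x)‖ ≤ ((1 + CF) * h⁻¹) ^ i := by
  refine (hB.2.2.1 i hi _ (mem_image_of_mem _ hx)).trans ?_
  rw [zpow_neg, zpow_natCast, mul_pow, inv_pow]
  gcongr
  exact (by linarith : CF ≤ 1 + CF).trans (le_self_pow₀ (by linarith) (by omega))

end InverseMap

lemma W_bound (k : ℕ) (CF c₁ : ℝ) (hCF : 0 < CF) (hc₁ : 0 < c₁) :
    ∃ C1 : ℝ, 0 < C1 ∧ ∀ (c₂ h : ℝ) (F : ℝ × ℝ → ℝ × ℝ), 0 < h → h ≤ 1 → VDeg k F →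
      IsoparamBounds k CF c₁ c₂ h F → ∀ (K : Set (ℝ × ℝ)), IsOpen K → K ⊆ Tref →
      ∀ wh w : ℝ × ℝ → ℝ × ℝ, ContDiffOn ℝ ∞ wh K → (∀ x ∈ K, w (F x) = Amap F x (wh x)) →
      ContDiffOn ℝ ∞ w (F '' K) ∧ ∀ j ≤ k + 1, ∀ x ∈ K,
        ‖iteratedFDeriv ℝ j w (F x)‖ ≤
          C1 * h⁻¹ ^ (j + 1) * ∑ i ∈ Finset.range (j + 1), ‖iteratedFDeriv ℝ i wh x‖ := by
  obtain ⟨KA, hKA, HA⟩ := A_bound (k + 1) CF c₁ hCF hc₁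
  refine ⟨(k + 1).factorial * (2 ^ (k + 1) * KA) * (1 + CF) ^ (k + 1), by positivity, ?_⟩
  intro c₂ h F hh hh1 hV hB K hK hKT wh w hwh hw
  set G := invFunOn F (closure Tref) with hG
  have hO : IsOpen (F '' K) := isOpen_image hc₁ hh hV hB hK hKT
  have hGc : ContDiffOn ℝ ∞ G (F '' K) := (contDiffOn_G hc₁ hh hV hB).mono (image_mono hKT)
  have hA : ContDiffOn ℝ ∞ (Amap F) K := (contDiffOn_Amap hc₁ hh hV hB).mono hKT
  have hAw : ContDiffOn ℝ ∞ (fun x => Amap F x (wh x)) K := hA.clm_apply hwh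
  have hmap : MapsTo G (F '' K) K := by
    rintro _ ⟨x, hx, rfl⟩
    rw [hG, G_left hB (hKT hx)]; exact hx
  have heq : EqOn w (fun y => (fun x => Amap F x (wh x)) (G y)) (F '' K) := by
    rintro _ ⟨x, hx, rfl⟩
    simp only
    rw [hG, G_left hB (hKT hx)]; exact hw x hx
  refine ⟨(hAw.comp hGc hmap).congr heq, ?_⟩
  intro j hj x hx
  set S := ∑ i ∈ Finset.range (j + 1), ‖iteratedFDeriv ℝ i wh x‖ with hS
  have hS0 : 0 ≤ S := Finset.sum_nonneg fun i _ => norm_nonneg _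
  have hGx : G (F x) = x := G_left hB (hKT hx)
  rw [eqOn_iteratedFDeriv hO heq j (mem_image_of_mem _ hx)]
  have key := comp_bound hO hK hAw hGc hmap (mem_image_of_mem _ hx) j
    (C := 2 ^ (k + 1) * (KA * h⁻¹ * S)) (D := (1 + CF) * h⁻¹) ?_
    (fun i h1 hi => G_bound hCF hh hB (hKT hx) i h1 (hi.trans hj))
  · refine key.trans ?_
    have hf : (j.factorial : ℝ) ≤ (k + 1).factorial := by
      exact_mod_cast Nat.factorial_le hj
    have hp : (1 + CF) ^ j ≤ (1 + CF) ^ (k + 1) := pow_le_pow_right₀ (by linarith) hj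
    rw [mul_pow]
    calc (j.factorial : ℝ) * (2 ^ (k + 1) * (KA * h⁻¹ * S)) * ((1 + CF) ^ j * h⁻¹ ^ j)
        ≤ (k + 1).factorial * (2 ^ (k + 1) * (KA * h⁻¹ * S)) * ((1 + CF) ^ (k + 1) * h⁻¹ ^ j) := by
          gcongr
      _ = _ := by ring
  · intro i hi
    rw [hGx]
    have := clm_bound hK hA hwh hx i (a := KA * h⁻¹) (b := S) (h := 1) zero_le_one
      (by positivity)
      (fun l hl => by
        simpa using HA k c₂ h F hh hh1 hV hB x (hKT hx) l (hl.trans (hi.trans hj)))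
      (fun l hl => by
        rw [one_pow, mul_one]
        exact Finset.single_le_sum (f := fun i => ‖iteratedFDeriv ℝ i wh x‖)
          (fun i _ => norm_nonneg _) (by simp; omega))
    refine this.trans ?_
    rw [one_pow, mul_one]
    have h2 : (2 : ℝ) ^ i ≤ 2 ^ (k + 1) := pow_le_pow_right₀ (by norm_num) (hi.trans hj)
    gcongr

lemma U_bound (l : ℕ) (CF : ℝ) (hCF : 0 < CF) :
    ∃ C2 : ℝ, 0 < C2 ∧ ∀ (k : ℕ) (c₁ c₂ h : ℝ) (F : ℝ × ℝ → ℝ × ℝ), 0 < c₁ → 0 < h → VDeg k F →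
      IsoparamBounds k CF c₁ c₂ h F →
      ∀ uh u : ℝ × ℝ → ℝ × ℝ, ContDiffOn ℝ ∞ u (F '' Tref) →
      (∀ x ∈ Tref, u (F x) = Amap F x (uh x)) → ∀ x ∈ Tref,
        ‖iteratedFDeriv ℝ l uh x‖ ≤
          C2 * h ^ (l + 1) * ∑ i ∈ Finset.range (l + 1), ‖iteratedFDeriv ℝ i u (F x)‖ := by
  refine ⟨2 ^ l * ((1 + ‖adjL‖) * CF * (l.factorial * (1 + CF) ^ l)), by positivity, ?_⟩
  intro k c₁ c₂ h F hc₁ hh hV hB uh u hu hpi x hx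
  have heq : EqOn uh (fun x => adjL (fderiv ℝ F x) (u (F x))) Tref := by
    intro y hy
    simp only
    rw [hpi y hy, adjL_Amap F y _ (jac_pos hc₁ hh hB hy).ne']
  set S := ∑ i ∈ Finset.range (l + 1), ‖iteratedFDeriv ℝ i u (F x)‖ with hS
  have hS0 : 0 ≤ S := Finset.sum_nonneg fun i _ => norm_nonneg _
  have hO : IsOpen (F '' Tref) := isOpen_image hc₁ hh hV hB isOpen_Tref subset_rfl
  have hFc : ContDiffOn ℝ ∞ F Tref := hV.1.contDiffOn
  have hm : MapsTo F Tref (F '' Tref) := mapsTo_image F Tref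
  have huF : ContDiffOn ℝ ∞ (fun x => u (F x)) Tref := hu.comp hFc hm
  have hadj : ContDiffOn ℝ ∞ (fun x => adjL (fderiv ℝ F x)) Tref :=
    (adjL.contDiff.comp (contDiff_fderiv' hV.1)).contDiffOn
  rw [eqOn_iteratedFDeriv isOpen_Tref heq l hx]
  have := clm_bound isOpen_Tref hadj huF hx l (a := (1 + ‖adjL‖) * CF * h)
    (b := l.factorial * (1 + CF) ^ l * S) hh.le (by positivity)
    (fun i hi => by
      refine (LDF_bound adjL hCF hh hV hB i hx).trans ?_
      gcongr
      linarith)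
    (fun i hi => by
      have := comp_bound isOpen_Tref hO hu hFc hm hx i (C := S) (D := (1 + CF) * h)
        (fun j hj => Finset.single_le_sum (f := fun i => ‖iteratedFDeriv ℝ i u (F x)‖)
          (fun i _ => norm_nonneg _) (by simp; omega))
        (fun j hj1 hj => by
          refine (F_bound hCF hh hV hB j hx).trans ?_
          rw [mul_pow]
          gcongr
          exact (by linarith : CF ≤ 1 + CF).trans (le_self_pow₀ (by linarith) (by omega)))
      refine this.trans ?_
      have hf : (i.factorial : ℝ) ≤ l.factorial := by
        exact_mod_cast Nat.factorial_le hi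
      have hp : (1 + CF) ^ i ≤ (1 + CF) ^ l := pow_le_pow_right₀ (by linarith) hi
      rw [mul_pow]
      calc (i.factorial : ℝ) * S * ((1 + CF) ^ i * h ^ i)
          ≤ l.factorial * S * ((1 + CF) ^ l * h ^ i) := by gcongr
        _ = _ := by ring)
  refine this.trans_eq ?_
  ring

/-! Integrals -/

lemma semiLp_eq {G : Type*} [NormedAddCommGroup G] [NormedSpace ℝ G]
    (m : ℕ) (w : ℝ × ℝ → G) (S : Set (ℝ × ℝ)) :
    semiLp m 2 w S = √(∫ x in S, ‖iteratedFDeriv ℝ m w x‖ ^ 2) := by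
  unfold semiLp
  rw [← Real.sqrt_eq_rpow]
  simp

lemma sqrt_sum_le' {ι : Type*} (s : Finset ι) (a : ι → ℝ) (ha : ∀ i, 0 ≤ a i) :
    √(∑ i ∈ s, a i) ≤ ∑ i ∈ s, √(a i) := by
  classical
  induction s using Finset.induction_on with
  | empty => simp
  | insert i s hi ih =>
    rw [Finset.sum_insert hi, Finset.sum_insert hi]
    have hs : 0 ≤ ∑ i ∈ s, a i := Finset.sum_nonneg fun i _ => ha i
    refine (Real.sqrt_le_iff.2 ⟨by positivity, ?_⟩).trans (add_le_add_right ih _)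
    have := Real.sq_sqrt hs
    have := Real.sq_sqrt (ha i)
    nlinarith [Real.sqrt_nonneg (a i), Real.sqrt_nonneg (∑ i ∈ s, a i),
      mul_nonneg (Real.sqrt_nonneg (a i)) (Real.sqrt_nonneg (∑ i ∈ s, a i))]

lemma L2_bound (n : ℕ) (S : Set (ℝ × ℝ)) (hS : MeasurableSet S) (f : ℝ × ℝ → ℝ)
    (g : ℕ → ℝ × ℝ → ℝ) (a : ℝ) (ha : 0 ≤ a)
    (hf : ∀ x ∈ S, 0 ≤ f x) (hfg : ∀ x ∈ S, f x ≤ a * ∑ j ∈ Finset.range n, g j x)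
    (hg : ∀ j < n, IntegrableOn (fun x => g j x ^ 2) S) :
    √(∫ x in S, f x ^ 2) ≤ a * n * ∑ j ∈ Finset.range n, √(∫ x in S, g j x ^ 2) := by
  have h1 : ∫ x in S, f x ^ 2 ≤ ∫ x in S, (a ^ 2 * n) * ∑ j ∈ Finset.range n, g j x ^ 2 := by
    refine integral_mono_of_nonneg (Filter.Eventually.of_forall fun x => sq_nonneg _) ?_ ?_
    · exact (integrable_finsetSum _ fun j hj => hg j (by simpa using hj)).const_mul _
    · refine (ae_restrict_iff' hS).2 (Filter.Eventually.of_forall fun x hx => ?_)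
      have h2 := pow_le_pow_left₀ (hf x hx) (hfg x hx) 2
      refine h2.trans ?_
      beta_reduce
      rw [mul_pow, mul_assoc]
      refine mul_le_mul_of_nonneg_left ?_ (sq_nonneg a)
      have := sq_sum_le_card_mul_sum_sq (s := Finset.range n) (f := fun j => g j x)
      simpa using this
  rw [integral_const_mul, integral_finsetSum _ fun j hj => hg j (by simpa using hj)] at h1
  refine (Real.sqrt_le_sqrt h1).trans ?_
  rw [Real.sqrt_mul (by positivity), Real.sqrt_mul (by positivity), Real.sqrt_sq ha]
  have hn : √(n : ℝ) ≤ n := by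
    rw [Real.sqrt_le_iff]
    refine ⟨by positivity, ?_⟩
    exact_mod_cast Nat.le_self_pow (by norm_num) n
  have hs := sqrt_sum_le' (Finset.range n) (fun j => ∫ x in S, g j x ^ 2)
    (fun j => integral_nonneg fun x => sq_nonneg _)
  gcongr

lemma semi_image {k : ℕ} {CF c₁ c₂ h : ℝ} {F : ℝ × ℝ → ℝ × ℝ} (hc₁ : 0 < c₁) (hh : 0 < h)
    (hV : VDeg k F) (hB : IsoparamBounds k CF c₁ c₂ h F) {K : Set (ℝ × ℝ)} (hK : IsOpen K)
    (hKT : K ⊆ Tref) (j : ℕ) (w : ℝ × ℝ → ℝ × ℝ) :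
    semiLp j 2 w (F '' K) =
      √(∫ x in K, (√(jacDet F x) * ‖iteratedFDeriv ℝ j w (F x)‖) ^ 2) := by
  rw [semiLp_eq, integral_image_eq_integral_abs_det_fderiv_smul volume hK.measurableSet
    (f' := fderiv ℝ F) (fun x _ => ((hV.1.differentiable (by simp)) x).hasFDerivAt.hasFDerivWithinAt)
    (hB.1.mono (hKT.trans subset_closure))]
  congr 1
  refine setIntegral_congr_fun hK.measurableSet fun x hx => ?_
  have hp := jac_pos hc₁ hh hB (hKT hx)
  have : (fderiv ℝ F x).det = jacDet F x := rfl
  simp only [this, smul_eq_mul]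
  rw [mul_pow, Real.sq_sqrt hp.le, abs_of_pos hp]

lemma integrable_image {k : ℕ} {CF c₁ c₂ h : ℝ} {F : ℝ × ℝ → ℝ × ℝ} (hc₁ : 0 < c₁) (hh : 0 < h)
    (hV : VDeg k F) (hB : IsoparamBounds k CF c₁ c₂ h F) (j : ℕ) (w : ℝ × ℝ → ℝ × ℝ)
    (hw : ContDiffOn ℝ ∞ w (F '' Tref)) {M : ℝ}
    (hM : ∀ x ∈ Tref, ‖iteratedFDeriv ℝ j w (F x)‖ ≤ M) :
    IntegrableOn (fun x => (√(jacDet F x) * ‖iteratedFDeriv ℝ j w (F x)‖) ^ 2) Tref := by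
  have hO := isOpen_image hc₁ hh hV hB isOpen_Tref subset_rfl
  have h1 : IntegrableOn (fun y => ‖iteratedFDeriv ℝ j w y‖ ^ 2) (F '' Tref) := by
    refine IntegrableOn.of_bound (C := M ^ 2) ?_ ?_ ?_
    · refine lt_of_le_of_lt (measure_mono (image_mono subset_closure)) ?_
      exact (isCompact_closure_Tref.image hV.1.continuous).measure_lt_top
    · exact (((continuousOn_iteratedFDeriv hO hw j).norm).pow 2).aestronglyMeasurable
        hO.measurableSet
    · refine (ae_restrict_iff' hO.measurableSet).2 (Filter.Eventually.of_forall ?_)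
      rintro _ ⟨x, hx, rfl⟩
      rw [Real.norm_of_nonneg (by positivity)]
      exact pow_le_pow_left₀ (norm_nonneg _) (hM x hx) 2
  rw [integrableOn_image_iff_integrableOn_abs_det_fderiv_smul volume isOpen_Tref.measurableSet
    (f' := fderiv ℝ F) (fun x _ => ((hV.1.differentiable (by simp)) x).hasFDerivAt.hasFDerivWithinAt)
    (hB.1.mono subset_closure)] at h1
  refine h1.congr_fun (fun x hx => ?_) isOpen_Tref.measurableSet
  have hp := jac_pos hc₁ hh hB hx
  have : (fderiv ℝ F x).det = jacDet F x := rfl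
  simp only [this, smul_eq_mul]
  rw [mul_pow, Real.sq_sqrt hp.le, abs_of_pos hp]

lemma integrable_ref {U : Set (ℝ × ℝ)} (hU : IsOpen U) (hTU : closure Tref ⊆ U)
    {w : ℝ × ℝ → ℝ × ℝ} (hw : ContDiffOn ℝ ∞ w U) (j : ℕ) :
    IntegrableOn (fun x => ‖iteratedFDeriv ℝ j w x‖ ^ 2) Tref :=
  ((((continuousOn_iteratedFDeriv hU hw j).mono hTU).norm.pow 2).integrableOn_compact
    isCompact_closure_Tref).mono_set subset_closure

lemma bounded_ref {U : Set (ℝ × ℝ)} (hU : IsOpen U) (hTU : closure Tref ⊆ U)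
    {w : ℝ × ℝ → ℝ × ℝ} (hw : ContDiffOn ℝ ∞ w U) (j : ℕ) :
    ∃ M, ∀ x ∈ Tref, ‖iteratedFDeriv ℝ j w x‖ ≤ M := by
  obtain ⟨M, hM⟩ := isCompact_closure_Tref.exists_bound_of_continuousOn
    ((continuousOn_iteratedFDeriv hU hw j).mono hTU)
  exact ⟨M, fun x hx => hM x (subset_closure hx)⟩

/-- Interpolation estimate carried through the Piola transform: if the piecewise polynomial
`v̂` approximates `û` on the reference Clough–Tocher split with constant `C₀`, then the Piola
transforms satisfy `Σᵢ |u − v|_{H^m(F(K̂ᵢ))} ≤ C h^{ℓ−m} ‖u‖_{H^ℓ(F(T̂))}`. -/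
theorem stmt14 (k ℓ m : ℕ) (hk : 2 ≤ k) (hℓ₁ : 2 ≤ ℓ) (hℓ₂ : ℓ ≤ k + 1) (hm : m ≤ ℓ)
    (C₀ : ℝ) (hC₀ : 0 < C₀)
    (CF c₁ c₂ : ℝ) (hCF : 0 < CF) (hc₁ : 0 < c₁) (hc₂ : 0 < c₂) :
    ∃ C : ℝ, 0 < C ∧ ∀ h : ℝ, h ∈ Set.Ioc (0 : ℝ) 1 → ∀ F : ℝ × ℝ → ℝ × ℝ,
      IsPolyMap k F → IsoparamBounds k CF c₁ c₂ h F →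
      ∀ uhat : ℝ × ℝ → ℝ × ℝ,
        (∃ U : Set (ℝ × ℝ), IsOpen U ∧ closure Tref ⊆ U ∧ ContDiffOn ℝ (⊤ : ℕ∞) uhat U) →
      ∀ vhat : ℝ × ℝ → ℝ × ℝ,
        ContinuousOn vhat (closure Tref) →
        (∀ i : Fin 3, ∃ P Q : MvPolynomial (Fin 2) ℝ,
          P.totalDegree ≤ k ∧ Q.totalDegree ≤ k ∧
          ∀ x ∈ closure (ctK i),
            vhat x = (MvPolynomial.eval ![x.1, x.2] P, MvPolynomial.eval ![x.1, x.2] Q)) →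
        (∑ j ∈ Finset.range (m + 1), ∑ i : Fin 3,
            semiLp j 2 (fun x => uhat x - vhat x) (ctK i)) ≤ C₀ * semiLp ℓ 2 uhat Tref →
      ∀ u v : ℝ × ℝ → ℝ × ℝ, IsPiola F uhat u → IsPiola F vhat v →
        (∑ i : Fin 3, semiLp m 2 (fun y => u y - v y) (F '' ctK i)) ≤
          C * h ^ (ℓ - m) * normWmp ℓ 2 u (F '' Tref) := by
  obtain ⟨C1, hC1, H1⟩ := W_bound k CF c₁ hCF hc₁
  obtain ⟨C2, hC2, H2⟩ := U_bound ℓ CF hCF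
  have hsc₁ : 0 < √c₁ := Real.sqrt_pos.2 hc₁
  have hsc₂ : 0 < √c₂ := Real.sqrt_pos.2 hc₂
  refine ⟨√c₂ * C1 * (m + 1) * C₀ * (C2 * (√c₁)⁻¹ * (ℓ + 1)), by positivity, ?_⟩
  rintro h ⟨hh, hh1⟩ F hP hB uhat ⟨U, hU, hTU, huU⟩ vhat hvc hvp happ u v hu hv
  have hV := hP.vdeg
  have hsqrt_up : ∀ x ∈ Tref, √(jacDet F x) ≤ √c₂ * h := by
    intro x hx
    have := Real.sqrt_le_sqrt (hB.2.2.2 x (subset_closure hx)).2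
    rwa [Real.sqrt_mul hc₂.le, Real.sqrt_sq hh.le] at this
  have hsqrt_lo : ∀ x ∈ Tref, √c₁ * h ≤ √(jacDet F x) := by
    intro x hx
    have := Real.sqrt_le_sqrt (hB.2.2.2 x (subset_closure hx)).1
    rwa [Real.sqrt_mul hc₁.le, Real.sqrt_sq hh.le] at this
  -- the local estimates on the subtriangles
  have step1 : ∀ i : Fin 3, semiLp m 2 (fun y => u y - v y) (F '' ctK i) ≤
      √c₂ * C1 * h⁻¹ ^ m * (m + 1) *
        ∑ j ∈ Finset.range (m + 1), semiLp j 2 (fun x => uhat x - vhat x) (ctK i) := by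
    intro i
    have hKT := ctK_subset i
    obtain ⟨P, Q, hPd, hQd, hPQ⟩ := hvp i
    set p : ℝ × ℝ → ℝ × ℝ := fun x =>
      (MvPolynomial.eval ![x.1, x.2] P, MvPolynomial.eval ![x.1, x.2] Q) with hp
    have hpc : ContDiff ℝ ∞ p := ((VDeg.poly P hPd).prodMk (VDeg.poly Q hQd)).1
    have hup : ContDiffOn ℝ ∞ (fun x => uhat x - p x) U := huU.sub hpc.contDiffOn
    have heq : EqOn (fun x => uhat x - vhat x) (fun x => uhat x - p x) (ctK i) := by
      intro x hx
      simp only [hp]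
      rw [hPQ x (subset_closure hx)]
    have hder : ∀ j, ∀ x ∈ ctK i, iteratedFDeriv ℝ j (fun x => uhat x - vhat x) x =
        iteratedFDeriv ℝ j (fun x => uhat x - p x) x := fun j x hx =>
      eqOn_iteratedFDeriv (isOpen_ctK i) heq j hx
    have hwh : ContDiffOn ℝ ∞ (fun x => uhat x - vhat x) (ctK i) :=
      (hup.mono ((hKT.trans subset_closure).trans hTU)).congr heq
    obtain ⟨-, hb⟩ := H1 c₂ h F hh hh1 hV hB (ctK i) (isOpen_ctK i) hKT
      (fun x => uhat x - vhat x) (fun y => u y - v y) hwh (by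
        intro x hx
        have hx' := subset_closure (hKT hx)
        rw [hu x hx', hv x hx', map_sub])
    rw [semi_image hc₁ hh hV hB (isOpen_ctK i) hKT]
    simp only [semiLp_eq]
    have := L2_bound (m + 1) (ctK i) (isOpen_ctK i).measurableSet
      (fun x => √(jacDet F x) * ‖iteratedFDeriv ℝ m (fun y => u y - v y) (F x)‖)
      (fun j x => ‖iteratedFDeriv ℝ j (fun x => uhat x - vhat x) x‖)
      (√c₂ * C1 * h⁻¹ ^ m) (by positivity) (fun x _ => by positivity) ?_ ?_
    · push_cast at this
      exact this
    · intro x hx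
      have e : √c₂ * C1 * h⁻¹ ^ m = (√c₂ * h) * (C1 * h⁻¹ ^ (m + 1)) := by
        rw [pow_succ]
        field_simp
      rw [e, mul_assoc (√c₂ * h)]
      exact mul_le_mul (hsqrt_up x (hKT hx)) (hb m (hm.trans hℓ₂) x hx) (norm_nonneg _)
        (by positivity)
    · intro j _
      refine ((integrable_ref hU hTU hup j).mono_set hKT).congr_fun (fun x hx => ?_)
        (isOpen_ctK i).measurableSet
      simp only
      rw [hder j x hx]
  have step2 : (∑ i : Fin 3, semiLp m 2 (fun y => u y - v y) (F '' ctK i)) ≤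
      √c₂ * C1 * h⁻¹ ^ m * (m + 1) * (C₀ * semiLp ℓ 2 uhat Tref) := by
    refine (Finset.sum_le_sum fun i _ => step1 i).trans ?_
    rw [← Finset.mul_sum, Finset.sum_comm]
    exact mul_le_mul_of_nonneg_left happ (by positivity)
  -- the global estimate
  have hpi : ∀ x ∈ Tref, u (F x) = Amap F x (uhat x) := fun x hx => hu x (subset_closure hx)
  obtain ⟨huc, hub⟩ := H1 c₂ h F hh hh1 hV hB Tref isOpen_Tref subset_rfl uhat u
    (huU.mono (subset_closure.trans hTU)) hpi
  have step3 : semiLp ℓ 2 uhat Tref ≤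
      C2 * (√c₁)⁻¹ * h ^ ℓ * (ℓ + 1) * normWmp ℓ 2 u (F '' Tref) := by
    unfold normWmp
    simp only [semi_image hc₁ hh hV hB isOpen_Tref subset_rfl]
    rw [semiLp_eq]
    have := L2_bound (ℓ + 1) Tref isOpen_Tref.measurableSet
      (fun x => ‖iteratedFDeriv ℝ ℓ uhat x‖)
      (fun j x => √(jacDet F x) * ‖iteratedFDeriv ℝ j u (F x)‖)
      (C2 * (√c₁)⁻¹ * h ^ ℓ) (by positivity) (fun x _ => by positivity) ?_ ?_
    · push_cast at this
      exact this
    · intro x hx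
      refine (H2 k c₁ c₂ h F hc₁ hh hV hB uhat u huc hpi x hx).trans ?_
      rw [← Finset.mul_sum]
      have hS0 : 0 ≤ ∑ i ∈ Finset.range (ℓ + 1), ‖iteratedFDeriv ℝ i u (F x)‖ :=
        Finset.sum_nonneg fun i _ => norm_nonneg _
      calc C2 * h ^ (ℓ + 1) * ∑ i ∈ Finset.range (ℓ + 1), ‖iteratedFDeriv ℝ i u (F x)‖
          = C2 * (√c₁)⁻¹ * h ^ ℓ *
            ((√c₁ * h) * ∑ i ∈ Finset.range (ℓ + 1), ‖iteratedFDeriv ℝ i u (F x)‖) := by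
            field_simp
            ring
        _ ≤ _ := by
            have := hsqrt_lo x hx
            gcongr
    · intro j hj
      choose M hM using fun i => bounded_ref hU hTU huU i
      refine integrable_image hc₁ hh hV hB j u huc
        (M := C1 * h⁻¹ ^ (j + 1) * ∑ i ∈ Finset.range (j + 1), M i) fun x hx => ?_
      refine (hub j (by omega) x hx).trans ?_
      refine mul_le_mul_of_nonneg_left ?_ (by positivity)
      exact Finset.sum_le_sum fun i _ => hM i x hx
  refine step2.trans ?_
  have e : h ^ (ℓ - m) = h⁻¹ ^ m * h ^ ℓ := by
    have : h ^ ℓ = h ^ m * h ^ (ℓ - m) := by rw [← pow_add]; congr 1; omega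
    rw [this, inv_pow, inv_mul_cancel_left₀ (by positivity)]
  calc √c₂ * C1 * h⁻¹ ^ m * (m + 1) * (C₀ * semiLp ℓ 2 uhat Tref)
      ≤ √c₂ * C1 * h⁻¹ ^ m * (m + 1) * (C₀ *
        (C2 * (√c₁)⁻¹ * h ^ ℓ * (ℓ + 1) * normWmp ℓ 2 u (F '' Tref))) := by gcongr
    _ = _ := by rw [e]; ring
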